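/- For n ≥ 2, the number of well-labelled Motzkin paths of size n starting with a +1 step equals (1/2)·Σ_{k=0}^{n} C(n,k)·a_k·a_{n-k}, where a_m denotes the number of well-labelled Motzkin paths of size m (with a_0 = a_1 = 0). -/

import Mathlib

/-- The steps of the word are letters in `{-1,0,+1}`. -/
def StepsOK (n : ℕ) (p : Fin (n - 1) → ℤ) : Prop :=
  ∀ i, p i = -1 ∨ p i = 0 ∨ p i = 1

/-- Compatibility between the word and the permutation: a `-1` step forces an ascent
of the labels and a `+1` step forces a descent. -/
def Compat (n : ℕ) (p : Fin (n - 1) → ℤ) (σ : Equiv.Perm (Fin n)) : Prop :=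
  ∀ i : Fin (n - 1),
    (p i = -1 → σ ⟨i.1, by have := i.isLt; omega⟩ < σ ⟨i.1 + 1, by have := i.isLt; omega⟩) ∧
    (p i = 1 → σ ⟨i.1 + 1, by have := i.isLt; omega⟩ < σ ⟨i.1, by have := i.isLt; omega⟩)

/-- Partial sum `p 1 + ... + p j` of the word. -/
def psum (n : ℕ) (p : Fin (n - 1) → ℤ) (j : ℕ) : ℤ :=
  ∑ i ∈ Finset.univ.filter (fun i : Fin (n - 1) => i.1 < j), p i

/-- Well-labelled positive path of size `n`. -/
def IsPositivePath (n : ℕ) (p : Fin (n - 1) → ℤ) (σ : Equiv.Perm (Fin n)) : Prop :=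
  StepsOK n p ∧ Compat n p σ ∧ ∀ j ≤ n - 1, 0 ≤ psum n p j

/-- Well-labelled Motzkin path of size `n`. -/
def IsMotzkinPath (n : ℕ) (p : Fin (n - 1) → ℤ) (σ : Equiv.Perm (Fin n)) : Prop :=
  StepsOK n p ∧ Compat n p σ ∧ (∀ j ≤ n - 2, 0 ≤ psum n p j) ∧ psum n p (n - 1) = -1

/-- Number of well-labelled Motzkin paths of size `n`. -/
noncomputable def motzkinCount (n : ℕ) : ℕ :=
  Nat.card {ps : (Fin (n - 1) → ℤ) × Equiv.Perm (Fin n) // IsMotzkinPath n ps.1 ps.2}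

/-- Number of well-labelled positive paths of size `n`. -/
noncomputable def positiveCount (n : ℕ) : ℕ :=
  Nat.card {ps : (Fin (n - 1) → ℤ) × Equiv.Perm (Fin n) // IsPositivePath n ps.1 ps.2}

/-- Number of horizontal steps (letters `0`) of a word. -/
def horizCount (n : ℕ) (p : Fin (n - 1) → ℤ) : ℕ :=
  (Finset.univ.filter (fun i => p i = 0)).card

open Filter Topology

/-- Integer walks of `n` steps of absolute value less than `N`, started at `0` and constant
after time `n`. -/
def walks (N n : ℕ) : Set (ℕ → ℤ) :=
  {Y | Y 0 = 0 ∧ (∀ i, Y (i + 1) - Y i < N ∧ Y i - Y (i + 1) < N) ∧ ∀ i, n ≤ i → Y i = Y n}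

/-- Walks that become negative for the first time at time `n`. -/
def descWalks (N n : ℕ) : Set (ℕ → ℤ) :=
  {Y | Y ∈ walks N n ∧ (∀ j, 0 < j → j < n → 0 ≤ Y j) ∧ Y n < 0}

/-- Walks ending at a nonnegative height which is a strict minimum over positive times. -/
def ascWalks (N n : ℕ) : Set (ℕ → ℤ) :=
  {Y | Y ∈ walks N n ∧ (∀ j, 0 < j → j < n → Y n < Y j) ∧ 0 ≤ Y n}

theorem walks_finite_and_ncard_le (N n : ℕ) :
    (walks N n).Finite ∧ (walks N n).ncard ≤ (2 * N) ^ n := by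
  set t : Finset (Fin n → ℤ) := Fintype.piFinset fun _ => Finset.Ioo (-(N : ℤ)) N
  let f : (ℕ → ℤ) → Fin n → ℤ := fun Y i => Y (i + 1) - Y i
  have hmaps : ∀ Y ∈ walks N n, f Y ∈ (t : Set (Fin n → ℤ)) := by
    intro Y hY
    simp only [t, Finset.mem_coe, Fintype.mem_piFinset, Finset.mem_Ioo, f]
    intro i
    have := hY.2.1 i
    omega
  have hinj : Set.InjOn f (walks N n) := by
    intro Y hY Z hZ h
    have key : ∀ i, i ≤ n → Y i = Z i := by
      intro i
      induction i with
      | zero => intro _; rw [hY.1, hZ.1]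
      | succ i ih =>
        intro hi
        have h1 := congrFun h ⟨i, hi⟩
        have h2 := ih (by omega)
        simp only [f] at h1
        omega
    funext i
    rcases le_total i n with hi | hi
    · exact key i hi
    · rw [hY.2.2 i hi, hZ.2.2 i hi, key n le_rfl]
  refine ⟨Set.Finite.of_injOn hmaps hinj t.finite_toSet, ?_⟩
  refine (Set.ncard_le_ncard_of_injOn f hmaps hinj t.finite_toSet).trans ?_
  rw [Set.ncard_coe_finset, Fintype.card_piFinset]
  simp only [Int.card_Ioo, Finset.prod_const, Finset.card_univ, Fintype.card_fin]
  exact Nat.pow_le_pow_left (by omega) n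

theorem walks_finite (N n : ℕ) : (walks N n).Finite := (walks_finite_and_ncard_le N n).1

theorem descWalks_finite (N n : ℕ) : (descWalks N n).Finite :=
  (walks_finite N n).subset fun _ h => h.1

theorem ascWalks_finite (N n : ℕ) : (ascWalks N n).Finite :=
  (walks_finite N n).subset fun _ h => h.1

/-- Walks whose intermediate heights are at least the initial height, above the final height,
and first minimal at time `k`. -/
def cutWalks (N n k : ℕ) : Set (ℕ → ℤ) :=
  {Y | Y ∈ walks N n ∧ (∀ j, 0 < j → j < n → 0 ≤ Y j ∧ Y n < Y j) ∧
    (∀ j, 0 < j → j < k → Y k < Y j) ∧ ∀ j, k < j → j < n → Y k ≤ Y j}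

theorem ncard_cutWalks (N : ℕ) {n k : ℕ} (hk : 0 < k) (hkn : k < n) :
    (cutWalks N n k).ncard = (ascWalks N k).ncard * (descWalks N (n - k)).ncard := by
  rw [← Set.ncard_prod]
  symm
  refine Set.ncard_congr (fun p _ j => p.1 j + p.2 (j - k)) ?_ ?_ ?_
  · rintro ⟨v, d⟩ ⟨⟨⟨hv0, hv1, hv2⟩, hv3, hv4⟩, ⟨hd0, hd1, hd2⟩, hd3, hd4⟩
    simp only at *
    have low : ∀ j, j ≤ k → d (j - k) = 0 := fun j hj => by
      rw [Nat.sub_eq_zero_of_le hj, hd0]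
    refine ⟨⟨?_, ?_, ?_⟩, ?_, ?_, ?_⟩
    · simp only; rw [low 0 (by omega), hv0, add_zero]
    · intro i
      simp only
      rcases lt_or_ge i k with hi | hi
      · rw [low i (by omega), low (i + 1) (by omega)]
        have := hv1 i
        omega
      · have e : i + 1 - k = (i - k) + 1 := by omega
        have := hd1 (i - k)
        rw [e, hv2 i hi, hv2 (i + 1) (by omega)]
        omega
    · intro i hi
      simp only
      rw [hv2 i (by omega), hv2 n (by omega), hd2 (i - k) (by omega)]
    · intro j hj hjn
      simp only
      rw [hv2 n (by omega)]
      rcases lt_trichotomy j k with h | h | h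
      · rw [low j (by omega)]
        have := hv3 j hj h
        omega
      · subst h
        rw [low j le_rfl]
        omega
      · have := hd3 (j - k) (by omega) (by omega)
        rw [hv2 j h.le]
        omega
    · intro j hj hjk
      have := hv3 j hj hjk
      simp only
      rw [low j hjk.le, low k le_rfl]
      omega
    · intro j hj hjn
      have := hd3 (j - k) (by omega) (by omega)
      simp only
      rw [low k le_rfl, hv2 j hj.le]
      omega
  · rintro ⟨v, d⟩ ⟨v', d'⟩ ⟨⟨⟨hv0, hv1, hv2⟩, hv3, hv4⟩, ⟨hd0, hd1, hd2⟩, hd3, hd4⟩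
      ⟨⟨⟨hv0', hv1', hv2'⟩, hv3', hv4'⟩, ⟨hd0', hd1', hd2'⟩, hd3', hd4'⟩ h
    simp only at *
    have hlow : ∀ j, j ≤ k → v j = v' j := by
      intro j hj
      have := congrFun h j
      simp only [Nat.sub_eq_zero_of_le hj, hd0, hd0'] at this
      omega
    have hv : v = v' := by
      funext j
      rcases le_total j k with hj | hj
      · exact hlow j hj
      · rw [hv2 j hj, hv2' j hj, hlow k le_rfl]
    have hd : d = d' := by
      funext j
      have := congrFun h (k + j)
      simp only [Nat.add_sub_cancel_left, hv] at this
      omega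
    rw [hv, hd]
  · rintro Y ⟨⟨h0, h1, h2⟩, h3, h4, h5⟩
    refine ⟨(fun j => Y (min j k), fun j => Y (k + j) - Y k), ⟨⟨⟨?_, ?_, ?_⟩, ?_, ?_⟩,
      ⟨?_, ?_, ?_⟩, ?_, ?_⟩, ?_⟩
    · simpa using h0
    · intro i
      simp only
      rcases lt_or_ge i k with hi | hi
      · rw [min_eq_left hi.le, min_eq_left (by omega : i + 1 ≤ k)]
        exact h1 i
      · rw [min_eq_right hi, min_eq_right (by omega : k ≤ i + 1)]
        have := h1 0
        omega
    · intro i hi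
      simp only
      rw [min_eq_right hi, min_self]
    · intro j hj hjk
      simp only
      rw [min_self, min_eq_left hjk.le]
      exact h4 j hj hjk
    · simp only
      rw [min_self]
      exact (h3 k hk hkn).1
    · simp
    · intro i
      have := h1 (k + i)
      simp only [← add_assoc]
      omega
    · intro i hi
      simp only
      rw [h2 (k + i) (by omega), h2 (k + (n - k)) (by omega)]
    · intro j hj hjn
      have := h5 (k + j) (by omega) (by omega)
      simp only
      omega
    · have := (h3 k hk hkn).2
      simp only
      rw [h2 (k + (n - k)) (by omega)]
      omega
    · funext j
      simp only
      rcases le_total j k with hj | hj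
      · rw [min_eq_left hj, Nat.sub_eq_zero_of_le hj]
        simp
      · rw [min_eq_right hj, Nat.add_sub_cancel' hj]
        ring

theorem desc_add_asc (N : ℕ) {n : ℕ} (hn : 2 ≤ n) :
    (descWalks N n).ncard + (ascWalks N n).ncard =
      ∑ k ∈ Finset.Ioo 0 n, (ascWalks N k).ncard * (descWalks N (n - k)).ncard := by
  rw [← Set.ncard_union_eq ?_ (descWalks_finite N n) (ascWalks_finite N n)]
  · have hU : descWalks N n ∪ ascWalks N n =
        ⋃ k ∈ (Finset.Ioo 0 n : Set ℕ), cutWalks N n k := by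
      ext Y
      simp only [Set.mem_union, Set.mem_iUnion, Finset.coe_Ioo, Set.mem_Ioo, exists_prop]
      constructor
      · intro hY
        have hw : Y ∈ walks N n ∧ ∀ j, 0 < j → j < n → 0 ≤ Y j ∧ Y n < Y j := by
          rcases hY with ⟨h, h1, h2⟩ | ⟨h, h1, h2⟩ <;>
          · refine ⟨h, fun j hj hjn => ?_⟩
            have := h1 j hj hjn
            omega
        obtain ⟨m, hm, hmin⟩ := (Finset.Ioo 0 n).exists_min_image Y ⟨1, by simp; omega⟩
        have hex : ∃ k, (0 < k ∧ k < n) ∧ Y k = Y m := ⟨m, by simpa using hm, rfl⟩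
        classical
        have hspec := Nat.find_spec hex
        refine ⟨Nat.find hex, hspec.1, hw.1, hw.2, ?_, ?_⟩
        · intro j hj hjk
          rw [hspec.2]
          have hjn : j < n := hjk.trans hspec.1.2
          refine lt_of_le_of_ne (hmin j (by simp; omega)) fun h => ?_
          exact Nat.find_min hex hjk ⟨⟨hj, hjn⟩, h.symm⟩
        · intro j hj hjn
          rw [hspec.2]
          exact hmin j (by simp; omega)
      · rintro ⟨k, hk, hw, h3, -, -⟩
        rcases lt_or_ge (Y n) 0 with h | h
        · exact Or.inl ⟨hw, fun j hj hjn => (h3 j hj hjn).1, h⟩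
        · exact Or.inr ⟨hw, fun j hj hjn => (h3 j hj hjn).2, h⟩
    rw [hU, Set.Finite.ncard_biUnion (Finset.finite_toSet _), finsum_mem_coe_finset]
    · refine Finset.sum_congr rfl fun k hk => ?_
      rw [Finset.mem_Ioo] at hk
      exact ncard_cutWalks N hk.1 hk.2
    · exact fun k _ => (walks_finite N n).subset fun _ h => h.1
    · intro k hk l hl hkl
      simp only [Finset.coe_Ioo, Set.mem_Ioo] at hk hl
      refine Set.disjoint_left.2 fun Y h h' => ?_
      rcases lt_or_gt_of_ne hkl with hlt | hlt
      · have a := h'.2.2.1 k hk.1 hlt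
        have b := h.2.2.2 l hlt hl.2
        omega
      · have a := h.2.2.1 l hl.1 hlt
        have b := h'.2.2.2 k hlt hk.2
        omega
  · exact Set.disjoint_left.2 fun Y h h' => absurd h.2.2 (not_lt.2 h'.2.2)

theorem asc_le_desc (N : ℕ) {n : ℕ} (hn : 2 ≤ n) :
    (ascWalks N n).ncard ≤ (descWalks N n).ncard := by
  refine Set.ncard_le_ncard_of_injOn
    (fun Y j => if j = 0 then 0 else Y (n - j) - Y n - 1) ?_ ?_ (descWalks_finite N n)
  · rintro Y ⟨⟨h0, h1, h2⟩, h3, h4⟩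
    have hN := h1 0
    refine ⟨⟨by simp, ?_, ?_⟩, ?_, ?_⟩
    · intro i
      by_cases hi : i = 0
      · subst hi
        have a := h3 (n - 1) (by omega) (by omega)
        have b := h1 (n - 1)
        rw [Nat.sub_add_cancel (by omega)] at b
        simp
        omega
      · rcases lt_or_ge i n with hin | hin
        · have b := h1 (n - (i + 1))
          rw [show n - (i + 1) + 1 = n - i by omega] at b
          simp [hi]
          omega
        · simp only [hi, if_false, Nat.succ_ne_zero, show n - i = 0 by omega,
            show n - (i + 1) = 0 by omega]
          omega
    · intro i hi
      simp [show i ≠ 0 by omega, show n ≠ 0 by omega, show n - i = 0 by omega]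
    · intro j hj hjn
      have a := h3 (n - j) (by omega) (by omega)
      simp [show j ≠ 0 by omega]
      omega
    · simp [show n ≠ 0 by omega, h0]
      omega
  · rintro Y ⟨⟨h0, h1, h2⟩, h3, h4⟩ Z ⟨⟨h0', h1', h2'⟩, h3', h4'⟩ h
    have hn' : Y n = Z n := by
      have a := congrFun h n
      simp [show n ≠ 0 by omega] at a
      omega
    funext i
    rcases lt_or_ge i n with hi | hi
    · have a := congrFun h (n - i)
      simp only [show n - i ≠ 0 by omega, if_false, show n - (n - i) = i by omega] at a
      omega
    · rw [h2 i hi, h2' i hi, hn']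

theorem desc_le_asc_add (N : ℕ) {n : ℕ} (hn : 2 ≤ n) :
    (descWalks N n).ncard ≤ (ascWalks N n).ncard + (2 * N) ^ (n - 1) := by
  have hsub : descWalks N n ⊆ {Y ∈ descWalks N n | Y 1 + 1 < N} ∪
      {Y ∈ walks N n | Y 1 = N - 1} := by
    rintro Y hY
    have := hY.1.2.1 0
    have h0 := hY.1.1
    simp only [zero_add, h0] at this
    rcases lt_or_ge (Y 1 + 1) N with h | h
    · exact Or.inl ⟨hY, h⟩
    · exact Or.inr ⟨hY.1, by omega⟩
  refine (Set.ncard_le_ncard hsub (((descWalks_finite N n).subset (Set.sep_subset _ _)).union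
    ((walks_finite N n).subset (Set.sep_subset _ _)))).trans ?_
  refine (Set.ncard_union_le _ _).trans (add_le_add ?_ ?_)
  · refine Set.ncard_le_ncard_of_injOn
      (fun Y j => if n ≤ j then - Y n - 1 else Y (n - j) - Y n) ?_ ?_ (ascWalks_finite N n)
    · rintro Y ⟨⟨⟨h0, h1, h2⟩, h3, h4⟩, h5⟩
      have hN := h1 0
      refine ⟨⟨by simp; omega, ?_, ?_⟩, ?_, ?_⟩
      · intro i
        rcases lt_or_ge (i + 1) n with hin | hin
        · have b := h1 (n - (i + 1))
          rw [show n - (i + 1) + 1 = n - i by omega] at b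
          simp only [not_le.2 hin, show ¬ n ≤ i by omega, if_false]
          omega
        · rcases lt_or_ge i n with hi | hi
          · have a := h3 1 (by omega) (by omega)
            simp only [hin, show ¬ n ≤ i by omega, if_false, if_true,
              show n - i = 1 by omega]
            omega
          · simp only [hin, hi, if_true]
            omega
      · intro i hi
        simp [hi]
      · intro j hj hjn
        have a := h3 (n - j) (by omega) (by omega)
        simp only [le_refl, if_true, not_le.2 hjn, if_false]
        omega
      · simp only [le_refl, if_true]
        omega
    · rintro Y ⟨⟨⟨h0, h1, h2⟩, h3, h4⟩, h5⟩ Z ⟨⟨⟨h0', h1', h2'⟩, h3', h4'⟩, h5'⟩ h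
      have hn' : Y n = Z n := by
        have a := congrFun h n
        simp only [le_refl, if_true] at a
        omega
      funext i
      rcases lt_or_ge i n with hi | hi
      · rcases Nat.eq_zero_or_pos i with rfl | hi0
        · rw [h0, h0']
        · have a := congrFun h (n - i)
          simp only [show ¬ n ≤ n - i by omega, if_false, show n - (n - i) = i by omega] at a
          omega
      · rw [h2 i hi, h2' i hi, hn']
  · refine le_trans ?_ (walks_finite_and_ncard_le N (n - 1)).2
    refine Set.ncard_le_ncard_of_injOn (fun Y j => Y (j + 1) - Y 1) ?_ ?_
      (walks_finite N (n - 1))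
    · rintro Y ⟨⟨h0, h1, h2⟩, h3⟩
      refine ⟨by simp, fun i => ?_, fun i hi => ?_⟩
      · have := h1 (i + 1)
        simp only
        omega
      · simp only
        rw [h2 (i + 1) (by omega), h2 (n - 1 + 1) (by omega)]
    · rintro Y ⟨⟨h0, h1, h2⟩, h3⟩ Z ⟨⟨h0', h1', h2'⟩, h3'⟩ h
      funext i
      cases i with
      | zero => rw [h0, h0']
      | succ i =>
        have := congrFun h i
        simp only at this
        omega

theorem ncard_descWalks_lt (N : ℕ) {n : ℕ} (hn : 3 ≤ n) :
    {Y ∈ descWalks N n | Y 2 < N}.ncard = N * (descWalks N (n - 1)).ncard := by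
  have hN : N = (Set.Ico (0 : ℤ) N).ncard := by
    rw [← Finset.coe_Ico, Set.ncard_coe_finset]
    simp
  conv_rhs => rw [hN, ← Set.ncard_prod, ← hN]
  refine Set.ncard_congr (fun Y _ => (Y 1, fun j => if j = 0 then 0 else Y (j + 1))) ?_ ?_ ?_
  · rintro Y ⟨⟨⟨h0, h1, h2⟩, h3, h4⟩, h5⟩
    have a := h1 0
    have b := h3 1 (by omega) (by omega)
    have c := h3 2 (by omega) (by omega)
    simp only [zero_add] at a
    refine ⟨by simp; omega, ⟨by simp, ?_, ?_⟩, ?_, ?_⟩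
    · intro i
      by_cases hi : i = 0
      · subst hi
        simp
        omega
      · have := h1 (i + 1)
        simpa [hi] using this
    · intro i hi
      simp only [show i ≠ 0 by omega, show n - 1 ≠ 0 by omega, if_false]
      rw [h2 (i + 1) (by omega), h2 (n - 1 + 1) (by omega)]
    · intro j hj hjn
      simpa [show j ≠ 0 by omega] using h3 (j + 1) (by omega) (by omega)
    · simpa [show n - 1 ≠ 0 by omega, show n - 1 + 1 = n by omega] using h4
  · rintro Y Z ⟨⟨⟨h0, h1, h2⟩, h3, h4⟩, h5⟩ ⟨⟨⟨h0', h1', h2'⟩, h3', h4'⟩, h5'⟩ h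
    rw [Prod.mk.injEq] at h
    funext i
    match i with
    | 0 => rw [h0, h0']
    | 1 => exact h.1
    | i + 2 => simpa using congrFun h.2 (i + 1)
  · rintro ⟨a, Y⟩ ⟨ha, ⟨h0, h1, h2⟩, h3, h4⟩
    simp only [Set.mem_Ico] at *
    have b := h1 0
    have c := h3 1 (by omega) (by omega)
    simp only [zero_add] at b
    refine ⟨fun j => if j = 0 then 0 else if j = 1 then a else Y (j - 1),
      ⟨⟨⟨by simp, ?_, ?_⟩, ?_, ?_⟩, ?_⟩, ?_⟩
    · intro i
      match i with
      | 0 => simp; omega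
      | 1 => simp; omega
      | i + 2 => simpa using h1 (i + 1)
    · intro i hi
      simp only [show i ≠ 0 by omega, show i ≠ 1 by omega, show n ≠ 0 by omega,
        show n ≠ 1 by omega, if_false]
      exact h2 _ (by omega)
    · intro j hj hjn
      match j, hj with
      | 1, _ => simpa using ha.1
      | j + 2, _ => simpa using h3 (j + 1) (by omega) (by omega)
    · simpa [show n ≠ 0 by omega, show n ≠ 1 by omega] using h4
    · simp
      omega
    · simp only [Prod.mk.injEq]
      refine ⟨by simp, ?_⟩
      funext j
      by_cases hj : j = 0
      · simp [hj, h0]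
      · simp [hj]

theorem ncard_descWalks_eq_add (N : ℕ) {n : ℕ} (hn : 3 ≤ n) :
    (descWalks N n).ncard =
      N * (descWalks N (n - 1)).ncard + {Y ∈ descWalks N n | (N : ℤ) ≤ Y 2}.ncard := by
  rw [← ncard_descWalks_lt N hn, ← Set.ncard_union_eq
    (s := {Y ∈ descWalks N n | Y 2 < N}) (t := {Y ∈ descWalks N n | (N : ℤ) ≤ Y 2})
    (Set.disjoint_left.2 fun Y h h' => absurd h.2 (not_lt.2 h'.2))
    ((descWalks_finite N n).subset (Set.sep_subset _ _))
    ((descWalks_finite N n).subset (Set.sep_subset _ _))]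
  congr 1
  ext Y
  simp only [Set.mem_union, Set.mem_ofPred_eq, ← and_or_left]
  exact ⟨fun h => ⟨h, lt_or_ge _ _⟩, fun h => h.1⟩

/-- Compatibility of a word with labels in an arbitrary ordered type. -/
def LabelCompat {α : Type*} [LT α] (n : ℕ) (p : Fin (n - 1) → ℤ) (s : Fin n → α) : Prop :=
  ∀ i : Fin (n - 1),
    (p i = -1 → s ⟨i.1, by have := i.isLt; omega⟩ < s ⟨i.1 + 1, by have := i.isLt; omega⟩) ∧
    (p i = 1 → s ⟨i.1 + 1, by have := i.isLt; omega⟩ < s ⟨i.1, by have := i.isLt; omega⟩)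

theorem LabelCompat.comp_orderEmbedding {α β : Type*} [Preorder α] [Preorder β] {n : ℕ}
    (p : Fin (n - 1) → ℤ) (s : Fin n → α) (e : α ↪o β) :
    LabelCompat n p (e ∘ s) ↔ LabelCompat n p s := by
  simp [LabelCompat]

/-- Pairs of a word in `W` and a compatible permutation. -/
def permPairs (n : ℕ) (W : Set (Fin (n - 1) → ℤ)) :
    Set ((Fin (n - 1) → ℤ) × Equiv.Perm (Fin n)) :=
  {x | x.1 ∈ W ∧ Compat n x.1 x.2}

/-- Pairs of a word in `W` and a compatible labelling by `Fin N`, repetitions allowed. -/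
def labelPairs (n N : ℕ) (W : Set (Fin (n - 1) → ℤ)) :
    Set ((Fin (n - 1) → ℤ) × (Fin n → Fin N)) :=
  {x | x.1 ∈ W ∧ LabelCompat n x.1 x.2}

theorem ncard_injective_labelPairs (n N : ℕ) (W : Set (Fin (n - 1) → ℤ)) :
    {x ∈ labelPairs n N W | Function.Injective x.2}.ncard =
      (permPairs n W).ncard * Nat.card (Fin n ↪o Fin N) := by
  rw [← Set.ncard_univ, ← Set.ncard_prod]
  symm
  refine Set.ncard_congr (fun x _ => (x.1.1, x.2 ∘ x.1.2)) ?_ ?_ ?_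
  · rintro ⟨⟨p, σ⟩, e⟩ ⟨⟨hp, hσ⟩, -⟩
    exact ⟨⟨hp, (LabelCompat.comp_orderEmbedding p σ e).2 hσ⟩,
      e.injective.comp σ.injective⟩
  · rintro ⟨⟨p, σ⟩, e⟩ ⟨⟨p', σ'⟩, e'⟩ - - h
    obtain ⟨rfl, h⟩ := Prod.mk.inj h
    have hr : Set.range e = Set.range e' := by
      rw [← σ.surjective.range_comp e, ← σ'.surjective.range_comp e']
      exact congrArg Set.range h
    have he : e = e' := by
      apply DFunLike.coe_injective
      exact (e.strictMono.range_inj e'.strictMono).1 hr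
    subst he
    have hσ : σ = σ' := Equiv.ext fun i => e.injective (congrFun h i)
    rw [hσ]
  · rintro ⟨p, s⟩ ⟨⟨hp, hs⟩, hinj⟩
    have hmono : StrictMono (s ∘ Tuple.sort s) :=
      (Tuple.monotone_sort s).strictMono_of_injective (hinj.comp (Tuple.sort s).injective)
    have hcomp : (OrderEmbedding.ofStrictMono _ hmono) ∘ (Tuple.sort s).symm = s := by
      funext i
      simp
    refine ⟨((p, (Tuple.sort s).symm), OrderEmbedding.ofStrictMono _ hmono),
      ⟨⟨hp, ?_⟩, Set.mem_univ _⟩, by rw [Prod.mk.injEq]; exact ⟨rfl, hcomp⟩⟩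
    rw [← hcomp] at hs
    exact (LabelCompat.comp_orderEmbedding p _ _).1 hs

theorem ncard_injective (n N : ℕ) :
    {s : Fin n → Fin N | Function.Injective s}.ncard = N.descFactorial n := by
  rw [← Nat.card_coe_set_eq,
    show Nat.card {s : Fin n → Fin N | Function.Injective s} = Nat.card (Fin n ↪ Fin N) from
      Nat.card_congr (Equiv.subtypeInjectiveEquivEmbedding _ _), Nat.card_eq_fintype_card,
    Fintype.card_embedding_eq, Fintype.card_fin, Fintype.card_fin]

theorem factorial_mul_card_orderEmbedding (n N : ℕ) :
    n.factorial * Nat.card (Fin n ↪o Fin N) = N.descFactorial n := by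
  have h := ncard_injective_labelPairs n N {0}
  have h1 : {x ∈ labelPairs n N {0} | Function.Injective x.2} =
      {0} ×ˢ {s : Fin n → Fin N | Function.Injective s} := by
    ext ⟨p, s⟩
    simp only [labelPairs, LabelCompat, Set.mem_ofPred_eq, Set.mem_singleton_iff, Set.mem_prod]
    constructor
    · rintro ⟨⟨rfl, -⟩, h⟩
      exact ⟨rfl, h⟩
    · rintro ⟨rfl, h⟩
      exact ⟨⟨rfl, fun i => by simp⟩, h⟩
  have h2 : permPairs n {0} = {0} ×ˢ Set.univ := by
    ext ⟨p, s⟩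
    simp only [permPairs, Compat, Set.mem_ofPred_eq, Set.mem_singleton_iff, Set.mem_prod]
    constructor
    · rintro ⟨rfl, -⟩
      exact ⟨rfl, trivial⟩
    · rintro ⟨rfl, -⟩
      exact ⟨rfl, fun i => by simp⟩
  rw [h1, h2, Set.ncard_prod, Set.ncard_prod, Set.ncard_singleton, one_mul, one_mul,
    ncard_injective, Set.ncard_univ, Nat.card_perm, Nat.card_fin] at h
  exact h.symm

theorem tendsto_descFactorial_div_pow (n : ℕ) :
    Tendsto (fun N : ℕ => (N.descFactorial n : ℝ) / (N : ℝ) ^ n) atTop (𝓝 1) := by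
  refine (Asymptotics.isEquivalent_iff_tendsto_one ?_).1 (isEquivalent_descFactorial n)
  filter_upwards [eventually_gt_atTop 0] with N hN
  positivity

theorem labelPairs_finite {n N : ℕ} {W : Set (Fin (n - 1) → ℤ)} (hW : W.Finite) :
    (labelPairs n N W).Finite :=
  (hW.prod Set.finite_univ).subset fun _ h => ⟨h.1, Set.mem_univ _⟩

theorem ncard_labelPairs_le {n N : ℕ} {W : Set (Fin (n - 1) → ℤ)} (hW : W.Finite) :
    (labelPairs n N W).ncard ≤
      {x ∈ labelPairs n N W | Function.Injective x.2}.ncard +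
        W.ncard * (N ^ n - N.descFactorial n) := by
  have hc : {s : Fin n → Fin N | Function.Injective s}ᶜ.ncard =
      N ^ n - N.descFactorial n := by
    rw [Set.ncard_compl, ncard_injective]
    simp
  rw [← hc, ← Set.ncard_prod]
  refine (Set.ncard_le_ncard (fun x hx => ?_)
    (((labelPairs_finite hW).subset (Set.sep_subset _ _)).union
      (hW.prod (Set.toFinite _)))).trans (Set.ncard_union_le _ _)
  by_cases h : Function.Injective x.2
  · exact Or.inl ⟨hx, h⟩
  · exact Or.inr ⟨hx.1, h⟩

theorem tendsto_labelPairs {n : ℕ} {W : Set (Fin (n - 1) → ℤ)} (hW : W.Finite) :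
    Tendsto (fun N : ℕ => ((labelPairs n N W).ncard : ℝ) / (N : ℝ) ^ n) atTop
      (𝓝 ((permPairs n W).ncard / n.factorial)) := by
  have hd := tendsto_descFactorial_div_pow n
  have hI : ∀ N : ℕ, ({x ∈ labelPairs n N W | Function.Injective x.2}.ncard : ℝ) =
      (permPairs n W).ncard / n.factorial * N.descFactorial n := by
    intro N
    rw [ncard_injective_labelPairs, ← factorial_mul_card_orderEmbedding]
    have : (n.factorial : ℝ) ≠ 0 := by positivity
    push_cast
    field_simp
  have hlow : Tendsto (fun N : ℕ => ((permPairs n W).ncard / n.factorial : ℝ) *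
      ((N.descFactorial n : ℝ) / (N : ℝ) ^ n)) atTop
      (𝓝 ((permPairs n W).ncard / n.factorial)) := by
    simpa using hd.const_mul ((permPairs n W).ncard / n.factorial : ℝ)
  have hup : Tendsto (fun N : ℕ => ((permPairs n W).ncard / n.factorial : ℝ) *
      ((N.descFactorial n : ℝ) / (N : ℝ) ^ n) +
        W.ncard * (1 - (N.descFactorial n : ℝ) / (N : ℝ) ^ n)) atTop
      (𝓝 ((permPairs n W).ncard / n.factorial)) := by
    simpa using hlow.add ((hd.const_sub 1).const_mul (W.ncard : ℝ))
  refine tendsto_of_tendsto_of_tendsto_of_le_of_le' hlow hup (.of_forall fun N => ?_) ?_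
  · rw [← mul_div_assoc, ← hI]
    gcongr
    · exact labelPairs_finite hW
    · exact Set.sep_subset _ _
  · filter_upwards [eventually_gt_atTop 0] with N hN
    have h := ncard_labelPairs_le (N := N) hW
    rify [Nat.descFactorial_le_pow N n] at h
    rw [hI] at h
    have hp : (0 : ℝ) < (N : ℝ) ^ n := by positivity
    rw [div_le_iff₀ hp]
    refine h.trans (le_of_eq ?_)
    field_simp

/-- Words of Motzkin paths of size `n`. -/
def motzkinWords (n : ℕ) : Set (Fin (n - 1) → ℤ) :=
  {p | StepsOK n p ∧ (∀ j ≤ n - 2, 0 ≤ psum n p j) ∧ psum n p (n - 1) = -1}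

theorem motzkinWords_finite (n : ℕ) : (motzkinWords n).Finite := by
  refine (Fintype.piFinset fun _ : Fin (n - 1) =>
    ({-1, 0, 1} : Finset ℤ)).finite_toSet.subset fun p hp => ?_
  simp only [Finset.mem_coe, Fintype.mem_piFinset, Finset.mem_insert, Finset.mem_singleton]
  exact hp.1

theorem psum_zero (n : ℕ) (p : Fin (n - 1) → ℤ) : psum n p 0 = 0 := by
  simp [psum]

theorem psum_succ (n : ℕ) (p : Fin (n - 1) → ℤ) {i : ℕ} (hi : i < n - 1) :
    psum n p (i + 1) = psum n p i + p ⟨i, hi⟩ := by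
  unfold psum
  have : Finset.univ.filter (fun k : Fin (n - 1) => k.1 < i + 1) =
      insert ⟨i, hi⟩ (Finset.univ.filter fun k : Fin (n - 1) => k.1 < i) := by
    ext k
    simp only [Finset.mem_filter, Finset.mem_univ, true_and, Finset.mem_insert, Fin.ext_iff]
    omega
  rw [this, Finset.sum_insert (by simp), add_comm]

/-- The walk whose floors and residues modulo `N` are the heights of `p` and the labels `s`. -/
def heightWalk {n N : ℕ} (hn : 0 < n) (p : Fin (n - 1) → ℤ) (s : Fin n → Fin N) : ℕ → ℤ
  | 0 => 0
  | i + 1 => N * psum n p (min i (n - 1)) + (s ⟨min i (n - 1), by omega⟩ : ℕ)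

theorem heightWalk_succ {n N : ℕ} (hn : 0 < n) (p : Fin (n - 1) → ℤ) (s : Fin n → Fin N)
    {i : ℕ} (hi : i < n) :
    heightWalk hn p s (i + 1) = N * psum n p i + (s ⟨i, hi⟩ : ℕ) := by
  have : min i (n - 1) = i := min_eq_left (by omega)
  simp only [heightWalk, this]

theorem heightWalk_of_le {n N : ℕ} (hn : 0 < n) (p : Fin (n - 1) → ℤ) (s : Fin n → Fin N)
    {i : ℕ} (hi : n ≤ i) : heightWalk hn p s i = heightWalk hn p s n := by
  obtain ⟨i, rfl⟩ : ∃ k, i = k + 1 := ⟨i - 1, by omega⟩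
  obtain ⟨m, rfl⟩ : ∃ k, n = k + 1 := ⟨n - 1, by omega⟩
  simp [heightWalk, show m ≤ i by omega]

theorem Int.eq_and_eq_of_mul_add_eq {N a b s t : ℤ} (hs : 0 ≤ s) (hs' : s < N) (ht : 0 ≤ t)
    (ht' : t < N) (h : N * a + s = N * b + t) : a = b ∧ s = t := by
  have hab : a = b := by
    have h1 : (N * a + s) / N = a := by
      rw [Int.mul_add_ediv_left _ _ (by omega), Int.ediv_eq_zero_of_lt hs hs', add_zero]
    have h2 : (N * b + t) / N = b := by
      rw [Int.mul_add_ediv_left _ _ (by omega), Int.ediv_eq_zero_of_lt ht ht', add_zero]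
    rw [← h1, h, h2]
  subst hab
  exact ⟨rfl, by omega⟩

theorem heightWalk_mem {n N : ℕ} (hn : 2 ≤ n) {p : Fin (n - 1) → ℤ} {s : Fin n → Fin N}
    (h : (p, s) ∈ labelPairs n N (motzkinWords n)) :
    heightWalk (by omega) p s ∈ descWalks N n := by
  obtain ⟨hp, hpos, hlast⟩ : p ∈ motzkinWords n := h.1
  have hc : LabelCompat n p s := h.2
  have hn0 : 0 < n := by omega
  refine ⟨⟨rfl, fun i => ?_, fun i hi => heightWalk_of_le hn0 p s hi⟩, ?_, ?_⟩
  · have hN := (s ⟨0, hn0⟩).isLt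
    rcases lt_or_ge i n with hi | hi
    · cases i with
      | zero =>
        rw [heightWalk_succ hn0 p s hn0, psum_zero]
        simp only [heightWalk]
        omega
      | succ i =>
        have hi' : i < n - 1 := by omega
        rw [heightWalk_succ hn0 p s hi, heightWalk_succ hn0 p s (by omega), psum_succ n p hi',
          mul_add]
        have h1 := (s ⟨i, by omega⟩).isLt
        have h2 := (s ⟨i + 1, hi⟩).isLt
        obtain ⟨hc1, hc2⟩ := hc ⟨i, hi'⟩
        rcases hp ⟨i, hi'⟩ with hpi | hpi | hpi
        · have h3 : (s ⟨i, by omega⟩ : ℕ) < s ⟨i + 1, hi⟩ := hc1 hpi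
          rw [hpi]
          omega
        · rw [hpi]
          omega
        · have h3 : (s ⟨i + 1, hi⟩ : ℕ) < s ⟨i, by omega⟩ := hc2 hpi
          rw [hpi]
          omega
    · rw [heightWalk_of_le hn0 p s hi, heightWalk_of_le hn0 p s (by omega : n ≤ i + 1)]
      omega
  · intro j hj hjn
    obtain ⟨i, rfl⟩ : ∃ k, j = k + 1 := ⟨j - 1, by omega⟩
    rw [heightWalk_succ hn0 p s (by omega)]
    have := hpos i (by omega)
    positivity
  · have := heightWalk_succ hn0 p s (i := n - 1) (by omega)
    rw [Nat.sub_add_cancel hn0, hlast] at this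
    have h1 := (s ⟨n - 1, by omega⟩).isLt
    rw [this]
    omega

theorem heightWalk_injective {n N : ℕ} (hn : 0 < n) {p p' : Fin (n - 1) → ℤ}
    {s s' : Fin n → Fin N} (h : heightWalk hn p s = heightWalk hn p' s') :
    p = p' ∧ s = s' := by
  have key : ∀ i (hi : i < n), psum n p i = psum n p' i ∧ s ⟨i, hi⟩ = s' ⟨i, hi⟩ := by
    intro i hi
    have h1 := congrFun h (i + 1)
    rw [heightWalk_succ hn p s hi, heightWalk_succ hn p' s' hi] at h1
    have h2 := (s ⟨i, hi⟩).isLt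
    have h3 := (s' ⟨i, hi⟩).isLt
    have h4 := Int.eq_and_eq_of_mul_add_eq (by omega) (by omega) (by omega) (by omega) h1
    exact ⟨h4.1, Fin.ext (by omega)⟩
  refine ⟨funext fun i => ?_, funext fun i => (key i.1 i.2).2⟩
  have h1 := (key i.1 (by omega)).1
  have h2 := (key (i.1 + 1) (by omega)).1
  rw [psum_succ n p i.2, psum_succ n p' i.2] at h2
  simpa [h1] using h2

theorem exists_heightWalk_eq {n N : ℕ} (hn : 2 ≤ n) {Y : ℕ → ℤ} (hY : Y ∈ descWalks N n) :
    ∃ p s, (p, s) ∈ labelPairs n N (motzkinWords n) ∧ heightWalk (by omega) p s = Y := by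
  obtain ⟨⟨h0, h1, h2⟩, h3, h4⟩ := hY
  have hN : (0 : ℤ) < N := by
    have := h1 0
    omega
  have hmod0 : ∀ i, 0 ≤ Y i % N := fun i => Int.emod_nonneg _ hN.ne'
  have hmod1 : ∀ i, Y i % N < N := fun i => Int.emod_lt_of_pos _ hN
  have hdm : ∀ i, (N : ℤ) * (Y i / N) + Y i % N = Y i := fun i => Int.mul_ediv_add_emod _ _
  let p : Fin (n - 1) → ℤ := fun i => Y (i + 2) / N - Y (i + 1) / N
  let s : Fin n → Fin N := fun i => ⟨(Y (i + 1) % N).toNat, by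
    have := hmod0 (i + 1)
    have := hmod1 (i + 1)
    omega⟩
  have hs : ∀ i (hi : i < n), ((s ⟨i, hi⟩ : ℕ) : ℤ) = Y (i + 1) % N := fun i hi => by
    simp [s, Int.toNat_of_nonneg (hmod0 (i + 1))]
  have hfloor1 : Y 1 / N = 0 := by
    have a := h1 0
    have b := h3 1 (by omega) (by omega)
    simp only [zero_add] at a
    exact Int.ediv_eq_zero_of_lt b (by omega)
  have hps : ∀ i, i < n → psum n p i = Y (i + 1) / N := by
    intro i
    induction i with
    | zero => intro _; rw [psum_zero, zero_add, hfloor1]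
    | succ i ih =>
      intro hi
      rw [psum_succ n p (by omega), ih (by omega)]
      simp only [p]
      ring
  have hstep : ∀ i : Fin (n - 1), (N : ℤ) * p i + Y (i + 2) % N - Y (i + 1) % N < N ∧
      -(N : ℤ) < N * p i + Y (i + 2) % N - Y (i + 1) % N := by
    intro i
    have a := h1 (i + 1)
    have b := hdm (i + 1)
    have c := hdm (i + 2)
    simp only [p, mul_sub]
    rw [show (i : ℕ) + 1 + 1 = i + 2 from rfl] at a
    omega
  have heq : heightWalk (by omega) p s = Y := by
    have low : ∀ i, i ≤ n → heightWalk (by omega) p s i = Y i := by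
      intro i hi
      cases i with
      | zero => rw [h0]; rfl
      | succ i => rw [heightWalk_succ _ p s hi, hps i hi, hs i hi, hdm]
    funext i
    rcases le_total i n with hi | hi
    · exact low i hi
    · rw [heightWalk_of_le _ p s hi, low n le_rfl, h2 i hi]
  refine ⟨p, s, ⟨⟨fun i => ?_, fun j hj => ?_, ?_⟩, fun i => ?_⟩, heq⟩
  · change p i = -1 ∨ p i = 0 ∨ p i = 1
    have a := hstep i
    have b := hmod0 (i + 1)
    have c := hmod1 (i + 1)
    have d := hmod0 (i + 2)
    have e := hmod1 (i + 2)
    have hlt : p i < 2 := by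
      by_contra! h
      nlinarith
    have hgt : -2 < p i := by
      by_contra! h
      nlinarith
    omega
  · rw [hps j (by omega)]
    exact Int.ediv_nonneg (h3 (j + 1) (by omega) (by omega)) hN.le
  · rw [hps (n - 1) (by omega), Nat.sub_add_cancel (by omega)]
    have a := h3 (n - 1) (by omega) (by omega)
    have b := h1 (n - 1)
    rw [Nat.sub_add_cancel (by omega)] at b
    have c := hdm n
    have d := hmod0 n
    have e := hmod1 n
    have f : Y n / N < 0 := Int.ediv_neg_of_neg_of_pos h4 hN
    have g : -2 < Y n / N := by
      by_contra! h
      nlinarith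
    omega
  · have a := hstep i
    constructor
    · intro (hi : p i = -1)
      rw [Fin.lt_def]
      zify
      rw [hs, hs]
      rw [hi] at a
      simp only [add_assoc]
      norm_num
      omega
    · intro (hi : p i = 1)
      rw [Fin.lt_def]
      zify
      rw [hs, hs]
      rw [hi] at a
      simp only [add_assoc]
      norm_num
      omega

theorem ncard_labelPairs_motzkinWords {n : ℕ} (N : ℕ) (hn : 2 ≤ n) :
    (labelPairs n N (motzkinWords n)).ncard = (descWalks N n).ncard := by
  refine Set.ncard_congr (fun x _ => heightWalk (by omega) x.1 x.2)
    (fun x hx => heightWalk_mem hn hx) ?_ ?_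
  · rintro ⟨p, s⟩ ⟨p', s'⟩ - - h
    obtain ⟨rfl, rfl⟩ := heightWalk_injective _ h
    rfl
  · intro Y hY
    obtain ⟨p, s, h, rfl⟩ := exists_heightWalk_eq hn hY
    exact ⟨(p, s), h, rfl⟩

theorem le_heightWalk_two_iff {n N : ℕ} (hn : 0 < n - 1) {p : Fin (n - 1) → ℤ} (hp : StepsOK n p)
    (s : Fin n → Fin N) :
    (N : ℤ) ≤ heightWalk (by omega) p s 2 ↔ p ⟨0, hn⟩ = 1 := by
  rw [heightWalk_succ _ p s (show 1 < n by omega), psum_succ n p hn,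
    psum_zero, zero_add]
  have := (s ⟨1, by omega⟩).isLt
  rcases hp ⟨0, hn⟩ with h | h | h <;> rw [h] <;> omega

theorem ncard_labelPairs_motzkinWords_start_one {n : ℕ} (N : ℕ) (hn : 0 < n - 1) :
    (labelPairs n N {p ∈ motzkinWords n | p ⟨0, hn⟩ = 1}).ncard =
      {Y ∈ descWalks N n | (N : ℤ) ≤ Y 2}.ncard := by
  refine Set.ncard_congr (fun x _ => heightWalk (by omega) x.1 x.2) ?_ ?_ ?_
  · rintro ⟨p, s⟩ ⟨⟨hp, h1⟩, hc⟩
    exact ⟨heightWalk_mem (by omega) ⟨hp, hc⟩, (le_heightWalk_two_iff hn hp.1 s).2 h1⟩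
  · rintro ⟨p, s⟩ ⟨p', s'⟩ - - h
    obtain ⟨rfl, rfl⟩ := heightWalk_injective _ h
    rfl
  · have hn2 : 2 ≤ n := by omega
    rintro Y ⟨hY, h2⟩
    obtain ⟨p, s, h, rfl⟩ := exists_heightWalk_eq hn2 hY
    exact ⟨(p, s), ⟨⟨h.1, (le_heightWalk_two_iff hn h.1.1 s).1 h2⟩, h.2⟩, rfl⟩

theorem motzkinCount_eq (n : ℕ) : motzkinCount n = (permPairs n (motzkinWords n)).ncard := by
  rw [motzkinCount, ← Nat.card_coe_set_eq]
  refine Nat.card_congr (Equiv.subtypeEquivRight fun x => ?_)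
  simp only [IsMotzkinPath, permPairs, motzkinWords, Set.mem_ofPred_eq]
  tauto

theorem motzkinCount_of_le_one {n : ℕ} (hn : n ≤ 1) : motzkinCount n = 0 := by
  rw [motzkinCount_eq]
  refine (congrArg Set.ncard (Set.eq_empty_of_forall_notMem fun x hx => ?_)).trans
    (Set.ncard_empty _)
  have h := (congrArg (psum n x.1) (show 0 = n - 1 by omega)).trans hx.1.2.2
  rw [psum_zero] at h
  omega

theorem ncard_walks_one (N : ℕ) (S : Finset ℤ) (hS : S ⊆ Finset.Ioo (-(N : ℤ)) N) :
    {Y ∈ walks N 1 | Y 1 ∈ S}.ncard = S.card := by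
  rw [← Set.ncard_coe_finset]
  refine Set.ncard_congr (fun Y _ => Y 1) (fun Y hY => hY.2) ?_ ?_
  · rintro Y Z ⟨⟨h0, -, h2⟩, -⟩ ⟨⟨h0', -, h2'⟩, -⟩ h
    funext i
    cases i with
    | zero => rw [h0, h0']
    | succ i => rw [h2 _ (by omega), h2' _ (by omega), h]
  · intro x hx
    have hx' := Finset.mem_Ioo.1 (hS hx)
    refine ⟨fun j => if j = 0 then 0 else x, ⟨⟨by simp, fun i => ?_, fun i hi => ?_⟩, ?_⟩, ?_⟩
    · by_cases hi : i = 0 <;> simp [hi] <;> omega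
    · simp [show i ≠ 0 by omega]
    · simpa using hx
    · simp

theorem ncard_descWalks_one (N : ℕ) : (descWalks N 1).ncard = N - 1 := by
  have h := ncard_walks_one N (Finset.Ioo (-(N : ℤ)) 0)
    (Finset.Ioo_subset_Ioo_right (by positivity))
  rw [Int.card_Ioo] at h
  convert h using 1
  · congr 1
    ext Y
    simp only [descWalks, Set.mem_ofPred_eq, Finset.mem_Ioo]
    refine and_congr_right fun hY => ⟨fun h => ⟨?_, h.2⟩, fun h => ⟨by omega, h.2⟩⟩
    have a := hY.2.1 0
    have b := hY.1
    simp only [zero_add] at a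
    omega
  · omega

theorem ncard_ascWalks_one (N : ℕ) : (ascWalks N 1).ncard = N := by
  rcases Nat.eq_zero_or_pos N with rfl | hN
  · refine (congrArg Set.ncard (Set.eq_empty_of_forall_notMem fun Y hY => ?_)).trans
      (Set.ncard_empty _)
    have := hY.1.2.1 0
    omega
  have h := ncard_walks_one N (Finset.Ico 0 (N : ℤ)) (by
    intro x
    simp only [Finset.mem_Ico, Finset.mem_Ioo]
    omega)
  rw [Int.card_Ico] at h
  convert h using 1
  · congr 1
    ext Y
    simp only [ascWalks, Set.mem_ofPred_eq, Finset.mem_Ico]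
    refine and_congr_right fun hY => ⟨fun h => ⟨h.2, ?_⟩, fun h => ⟨by omega, h.1⟩⟩
    have a := hY.2.1 0
    have b := hY.1
    simp only [zero_add] at a
    omega
  · omega

/-- Limiting density of `descWalks` and `ascWalks`. -/
noncomputable def walkDensity (n : ℕ) : ℝ :=
  motzkinCount n / n.factorial + if n = 1 then 1 else 0

theorem tendsto_descWalks {n : ℕ} (hn : 0 < n) :
    Tendsto (fun N : ℕ => ((descWalks N n).ncard : ℝ) / (N : ℝ) ^ n) atTop
      (𝓝 (walkDensity n)) := by
  rcases eq_or_ne n 1 with rfl | hn1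
  · have h : Tendsto (fun N : ℕ => (1 : ℝ) - 1 / (N : ℝ)) atTop (𝓝 1) := by
      simpa using tendsto_one_div_atTop_nhds_zero_nat (𝕜 := ℝ) |>.const_sub 1
    simp only [walkDensity, motzkinCount_of_le_one le_rfl, if_true, Nat.cast_zero, zero_div,
      zero_add]
    refine h.congr' ?_
    filter_upwards [eventually_gt_atTop 0] with N hN
    rw [ncard_descWalks_one, Nat.cast_sub hN]
    field_simp
    simp
  · have h := tendsto_labelPairs (motzkinWords_finite n)
    simp only [ncard_labelPairs_motzkinWords _ (show 2 ≤ n by omega), ← motzkinCount_eq] at h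
    simpa [walkDensity, hn1] using h

theorem tendsto_ascWalks {n : ℕ} (hn : 0 < n) :
    Tendsto (fun N : ℕ => ((ascWalks N n).ncard : ℝ) / (N : ℝ) ^ n) atTop
      (𝓝 (walkDensity n)) := by
  rcases eq_or_ne n 1 with rfl | hn1
  · simp only [walkDensity, motzkinCount_of_le_one le_rfl, if_true, Nat.cast_zero, zero_div,
      zero_add]
    refine tendsto_const_nhds.congr' ?_
    filter_upwards [eventually_gt_atTop 0] with N hN
    rw [ncard_ascWalks_one]
    field_simp
  · have hn2 : 2 ≤ n := by omega
    have hd := tendsto_descWalks hn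
    have h : Tendsto (fun N : ℕ => ((descWalks N n).ncard : ℝ) / (N : ℝ) ^ n -
        2 ^ (n - 1) * (1 / (N : ℝ))) atTop (𝓝 (walkDensity n)) := by
      simpa using hd.sub (tendsto_one_div_atTop_nhds_zero_nat (𝕜 := ℝ) |>.const_mul (2 ^ (n - 1)))
    refine tendsto_of_tendsto_of_tendsto_of_le_of_le' h hd ?_ (.of_forall fun N => ?_)
    · filter_upwards [eventually_gt_atTop 0] with N hN
      have hle : ((descWalks N n).ncard : ℝ) ≤ (ascWalks N n).ncard + (2 * N) ^ (n - 1) := by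
        exact_mod_cast desc_le_asc_add N hn2
      have hpow : (2 * (N : ℝ)) ^ (n - 1) / (N : ℝ) ^ n = 2 ^ (n - 1) * (1 / (N : ℝ)) := by
        obtain ⟨m, rfl⟩ : ∃ m, n = m + 1 := ⟨n - 1, by omega⟩
        simp only [Nat.add_sub_cancel]
        field_simp
        ring
      rw [← hpow, ← sub_div]
      gcongr
      linarith
    · exact div_le_div_of_nonneg_right (Nat.cast_le.2 (asc_le_desc N hn2)) (by positivity)

theorem two_mul_walkDensity {n : ℕ} (hn : 2 ≤ n) :
    2 * walkDensity n = ∑ k ∈ Finset.Ioo 0 n, walkDensity k * walkDensity (n - k) := by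
  have h1 := (tendsto_descWalks (show 0 < n by omega)).add
    (tendsto_ascWalks (show 0 < n by omega))
  have h2 : Tendsto (fun N : ℕ => ∑ k ∈ Finset.Ioo 0 n,
      ((ascWalks N k).ncard : ℝ) / (N : ℝ) ^ k *
        (((descWalks N (n - k)).ncard : ℝ) / (N : ℝ) ^ (n - k))) atTop
      (𝓝 (∑ k ∈ Finset.Ioo 0 n, walkDensity k * walkDensity (n - k))) := by
    refine tendsto_finsetSum _ fun k hk => ?_
    rw [Finset.mem_Ioo] at hk
    exact (tendsto_ascWalks hk.1).mul (tendsto_descWalks (by omega))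
  rw [two_mul]
  refine tendsto_nhds_unique h1 (h2.congr fun N => ?_)
  rw [← add_div, ← Nat.cast_add, desc_add_asc N hn, Nat.cast_sum, Finset.sum_div]
  refine Finset.sum_congr rfl fun k hk => ?_
  rw [Finset.mem_Ioo] at hk
  rw [div_mul_div_comm, ← pow_add, Nat.add_sub_cancel' hk.2.le, Nat.cast_mul]

theorem walkDensity_eq_add {n : ℕ} (hn : 3 ≤ n) :
    walkDensity n = walkDensity (n - 1) +
      (permPairs n {p ∈ motzkinWords n | p ⟨0, by omega⟩ = 1}).ncard / n.factorial := by
  have h := tendsto_labelPairs ((motzkinWords_finite n).subset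
    (Set.sep_subset _ fun p => p ⟨0, by omega⟩ = 1))
  simp only [ncard_labelPairs_motzkinWords_start_one _ (show 0 < n - 1 by omega)] at h
  refine tendsto_nhds_unique (tendsto_descWalks (by omega))
    (((tendsto_descWalks (show 0 < n - 1 by omega)).add h).congr' ?_)
  filter_upwards [eventually_gt_atTop 0] with N hN
  rw [ncard_descWalks_eq_add N hn, Nat.cast_add, Nat.cast_mul, add_div]
  congr 1
  obtain ⟨m, rfl⟩ : ∃ m, n = m + 1 := ⟨n - 1, by omega⟩
  simp only [Nat.add_sub_cancel]
  field_simp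
  ring

theorem sum_walkDensity {n : ℕ} (hn : 3 ≤ n) :
    ∑ k ∈ Finset.Ioo 0 n, walkDensity k * walkDensity (n - k) =
      ∑ k ∈ Finset.range (n + 1), ((motzkinCount k : ℝ) / k.factorial) *
        (motzkinCount (n - k) / (n - k).factorial) + 2 * walkDensity (n - 1) := by
  have hsub : Finset.Ioo 0 n ⊆ Finset.range (n + 1) := fun k hk => by
    simp only [Finset.mem_Ioo, Finset.mem_range] at *
    omega
  have h0 : walkDensity 0 = 0 := by simp [walkDensity, motzkinCount_of_le_one]
  rw [Finset.sum_subset hsub]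
  · have key : ∀ k ∈ Finset.range (n + 1), walkDensity k * walkDensity (n - k) =
        ((motzkinCount k : ℝ) / k.factorial) * (motzkinCount (n - k) / (n - k).factorial) +
          ((if k = 1 then walkDensity (n - 1) else 0) +
            if k = n - 1 then walkDensity (n - 1) else 0) := by
      intro k hk
      rw [Finset.mem_range] at hk
      by_cases h1 : k = 1
      · subst h1
        simp [walkDensity, motzkinCount_of_le_one, show n - 1 ≠ 1 by omega,
          show 1 ≠ n - 1 by omega]
      · by_cases h2 : k = n - 1
        · subst h2
          simp [walkDensity, motzkinCount_of_le_one, show n - 1 ≠ 1 by omega,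
            show n - (n - 1) = 1 by omega]
        · simp [walkDensity, h1, h2, show n - k ≠ 1 by omega]
    rw [Finset.sum_congr rfl key, Finset.sum_add_distrib, Finset.sum_add_distrib,
      Finset.sum_ite_eq', Finset.sum_ite_eq', if_pos (Finset.mem_range.2 (by omega)),
      if_pos (Finset.mem_range.2 (by omega))]
    ring
  · intro k hk hk'
    simp only [Finset.mem_Ioo, Finset.mem_range] at hk hk'
    rcases Nat.eq_zero_or_pos k with rfl | hk0
    · rw [h0, zero_mul]
    · rw [show n - k = 0 by omega, h0, mul_zero]

/-- For `n ≥ 2`, the number of well-labelled Motzkin paths of size `n` starting with a `+1`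
step equals `(1/2)·Σ_{k=0}^{n} C(n,k)·a_k·a_{n-k}`. -/
theorem motzkin_start_one_count (n : ℕ) (hn : 2 ≤ n) :
    (Nat.card {ps : (Fin (n - 1) → ℤ) × Equiv.Perm (Fin n) //
        IsMotzkinPath n ps.1 ps.2 ∧ ps.1 ⟨0, by omega⟩ = 1} : ℚ) =
      (1 / 2) * ∑ k ∈ Finset.range (n + 1),
        (n.choose k : ℚ) * (motzkinCount k : ℚ) * (motzkinCount (n - k) : ℚ) := by
  have hcard : Nat.card {ps : (Fin (n - 1) → ℤ) × Equiv.Perm (Fin n) //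
        IsMotzkinPath n ps.1 ps.2 ∧ ps.1 ⟨0, by omega⟩ = 1} =
      (permPairs n {p ∈ motzkinWords n | p ⟨0, by omega⟩ = 1}).ncard := by
    rw [← Nat.card_coe_set_eq]
    refine Nat.card_congr (Equiv.subtypeEquivRight fun x => ?_)
    simp only [IsMotzkinPath, permPairs, motzkinWords, Set.mem_ofPred_eq]
    tauto
  rw [hcard]
  rcases hn.eq_or_lt with rfl | hn3
  · have hempty : permPairs 2 {p ∈ motzkinWords 2 | p ⟨0, by omega⟩ = 1} = ∅ := by
      refine Set.eq_empty_of_forall_notMem fun x hx => ?_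
      have h := hx.1.1.2.2
      rw [psum_succ 2 x.1 (show 0 < 2 - 1 by omega), psum_zero, hx.1.2] at h
      omega
    rw [hempty]
    simp [Finset.sum_range_succ, motzkinCount_of_le_one]
  · have h := two_mul_walkDensity hn
    rw [sum_walkDensity hn3, walkDensity_eq_add hn3] at h
    have hn0 : (n.factorial : ℝ) ≠ 0 := by positivity
    apply Rat.cast_injective (α := ℝ)
    push_cast
    have hsum : ∑ k ∈ Finset.range (n + 1),
        (n.choose k : ℝ) * (motzkinCount k : ℝ) * (motzkinCount (n - k) : ℝ) =
        n.factorial * ∑ k ∈ Finset.range (n + 1), ((motzkinCount k : ℝ) / k.factorial) *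
          (motzkinCount (n - k) / (n - k).factorial) := by
      rw [Finset.mul_sum]
      refine Finset.sum_congr rfl fun k hk => ?_
      rw [Nat.cast_choose ℝ (Nat.lt_succ_iff.1 (Finset.mem_range.1 hk))]
      ring
    rw [hsum, ← sub_eq_zero]
    field_simp at h ⊢
    linarith
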